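/- Let U be a finite-dimensional alternative algebra over F with a nontrivial idempotent e, and let U = U_{11} ⊕ U_{10} ⊕ U_{01} ⊕ U_{00} be the Peirce decomposition relative to e. Let N be a two-sided ideal of U which is nil and contains every nil two-sided ideal of U (i.e. N is the nilradical R(U)), and for i ∈ {0,1} let N_i be a two-sided ideal of the subalgebra U_{ii} which is nil and contains every nil two-sided ideal of U_{ii} (i.e. N_i is the nilradical R(U_{ii})). Then N_i = N ∩ U_{ii} for i = 0, 1. -/

import Mathlib

/-! The nilradical of the diagonal Peirce subalgebras of a finite-dimensional
alternative algebra with respect to a nontrivial idempotent. -/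

/-- Left powers: `lpow x n = x^(n+1)`.  In an alternative (hence
power-associative) ring powers of a single element are unambiguous. -/
def lpow {U : Type*} [Mul U] (x : U) : ℕ → U
  | 0 => x
  | n + 1 => x * lpow x n

/-- An element is nil(potent) if some power of it vanishes. -/
def IsNilElem {U : Type*} [Mul U] [Zero U] (x : U) : Prop := ∃ n : ℕ, lpow x n = 0

section Peirce

variable (F : Type*) [Field F] (U : Type*) [NonUnitalNonAssocRing U]
  [Module F U] [SMulCommClass F U U] [IsScalarTower F U U]

/-- The Peirce subspace `U_{11} = {x | e·x = x ∧ x·e = x}` of an idempotent `e`. -/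
def peirceOneOne (e : U) : Submodule F U where
  carrier := {x | e * x = x ∧ x * e = x}
  add_mem' := by
    rintro a b ⟨ha1, ha2⟩ ⟨hb1, hb2⟩
    exact ⟨by rw [mul_add, ha1, hb1], by rw [add_mul, ha2, hb2]⟩
  zero_mem' := ⟨mul_zero e, zero_mul e⟩
  smul_mem' := by
    rintro c a ⟨ha1, ha2⟩
    exact ⟨by rw [mul_smul_comm, ha1], by rw [smul_mul_assoc, ha2]⟩

/-- The Peirce subspace `U_{00} = {x | e·x = 0 ∧ x·e = 0}` of an idempotent `e`. -/
def peirceZeroZero (e : U) : Submodule F U where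
  carrier := {x | e * x = 0 ∧ x * e = 0}
  add_mem' := by
    rintro a b ⟨ha1, ha2⟩ ⟨hb1, hb2⟩
    exact ⟨by rw [mul_add, ha1, hb1, add_zero], by rw [add_mul, ha2, hb2, add_zero]⟩
  zero_mem' := ⟨mul_zero e, zero_mul e⟩
  smul_mem' := by
    rintro c a ⟨ha1, ha2⟩
    exact ⟨by rw [mul_smul_comm, ha1, smul_zero], by rw [smul_mul_assoc, ha2, smul_zero]⟩

end Peirce

section Engel

variable {F V : Type*} [Field F] [AddCommGroup V] [Module F V]

/-- The span of all `t v` with `t ∈ T` and `v ∈ p`. -/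
def actSpan (T : Submodule F (Module.End F V)) (p : Submodule F V) : Submodule F V :=
  Submodule.map₂ (LinearMap.id : Module.End F V →ₗ[F] V →ₗ[F] V) T p

lemma actSpan_le {T : Submodule F (Module.End F V)} {p q : Submodule F V} :
    actSpan T p ≤ q ↔ ∀ t ∈ T, ∀ v ∈ p, t v ∈ q :=
  Submodule.map₂_le

lemma apply_mem_actSpan {T : Submodule F (Module.End F V)} {p : Submodule F V}
    {t : Module.End F V} {v : V} (ht : t ∈ T) (hv : v ∈ p) : t v ∈ actSpan T p :=
  Submodule.apply_mem_map₂ _ ht hv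

lemma actSpan_mono (T : Submodule F (Module.End F V)) {p q : Submodule F V} (h : p ≤ q) :
    actSpan T p ≤ actSpan T q :=
  Submodule.map₂_le_map₂_right h

/-- The operators on an invariant subspace `W` that are restrictions of elements of `D`. -/
def restrictOps (D : Submodule F (Module.End F V)) (W : Submodule F V) :
    Submodule F (Module.End F W) where
  carrier := {s | ∃ d ∈ D, ∀ w, (s w : V) = d w}
  add_mem' := by
    rintro a b ⟨d, hd, h⟩ ⟨d', hd', h'⟩
    exact ⟨d + d', D.add_mem hd hd', fun w => by simp [h, h']⟩
  zero_mem' := ⟨0, D.zero_mem, fun w => by simp⟩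
  smul_mem' := by
    rintro r a ⟨d, hd, h⟩
    exact ⟨r • d, D.smul_mem r hd, fun w => by simp [h]⟩

/-- The operators on the quotient by `W` induced by elements of `D`. -/
def quotientOps (D : Submodule F (Module.End F V)) (W : Submodule F V) :
    Submodule F (Module.End F (V ⧸ W)) where
  carrier := {s | ∃ d ∈ D, ∀ v, s (W.mkQ v) = W.mkQ (d v)}
  add_mem' := by
    rintro a b ⟨d, hd, h⟩ ⟨d', hd', h'⟩
    exact ⟨d + d', D.add_mem hd hd', fun w => by simp only [LinearMap.add_apply, h, h', map_add]⟩
  zero_mem' := ⟨0, D.zero_mem, fun w => by simp⟩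
  smul_mem' := by
    rintro r a ⟨d, hd, h⟩
    exact ⟨r • d, D.smul_mem r hd, fun w => by simp only [LinearMap.smul_apply, h, map_smul]⟩

lemma iterate_actSpan_le_map_subtype {D : Submodule F (Module.End F V)} {W : Submodule F V}
    (hD : ∀ d ∈ D, ∀ w ∈ W, d w ∈ W) (n : ℕ) :
    (actSpan D)^[n] W ≤ ((actSpan (restrictOps D W))^[n] ⊤).map W.subtype := by
  induction n with
  | zero => simp
  | succ n ih =>
    rw [Function.iterate_succ_apply', Function.iterate_succ_apply']
    refine (actSpan_mono D ih).trans (actSpan_le.2 ?_)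
    rintro t ht _ ⟨w, hw, rfl⟩
    exact ⟨t.restrict (hD t ht) w,
      apply_mem_actSpan ⟨t, ht, fun _ => rfl⟩ hw, rfl⟩

lemma map_mkQ_iterate_actSpan_le {D : Submodule F (Module.End F V)} {W : Submodule F V}
    (hD : ∀ d ∈ D, ∀ w ∈ W, d w ∈ W) (n : ℕ) :
    ((actSpan D)^[n] ⊤).map W.mkQ ≤ (actSpan (quotientOps D W))^[n] ⊤ := by
  induction n with
  | zero => simp
  | succ n ih =>
    rw [Function.iterate_succ_apply', Function.iterate_succ_apply', Submodule.map_le_iff_le_comap,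
      actSpan_le]
    intro t ht v hv
    have hq : W.mapQ W t (hD t ht) ∈ quotientOps D W := ⟨t, ht, fun _ => rfl⟩
    exact apply_mem_actSpan hq (ih ⟨v, hv, rfl⟩)

lemma exists_iterate_actSpan_of_invariant {D : Submodule F (Module.End F V)} {W : Submodule F V}
    (hD : ∀ d ∈ D, ∀ w ∈ W, d w ∈ W)
    (hres : ∃ k, (actSpan (restrictOps D W))^[k] ⊤ = ⊥)
    (hquot : ∃ l, (actSpan (quotientOps D W))^[l] ⊤ = ⊥) :
    ∃ n, (actSpan D)^[n] ⊤ = ⊥ := by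
  obtain ⟨k, hk⟩ := hres
  obtain ⟨l, hl⟩ := hquot
  refine ⟨k + l, ?_⟩
  have h := map_mkQ_iterate_actSpan_le hD l
  rw [hl, Submodule.map_le_iff_le_comap, Submodule.comap_bot, Submodule.ker_mkQ] at h
  have h' := iterate_actSpan_le_map_subtype hD k
  rw [hk, Submodule.map_bot] at h'
  rw [Function.iterate_add_apply, eq_bot_iff]
  exact (Monotone.iterate (fun _ _ => actSpan_mono D) k h).trans h'

lemma apply_mem_iterate_actSpan (T : Submodule F (Module.End F V)) (n : ℕ) :
    ∀ x ∈ T ^ n, ∀ v, x v ∈ (actSpan T)^[n] ⊤ := by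
  induction n with
  | zero => intro x _ v; simp
  | succ n ih =>
    intro x hx v
    rw [pow_succ'] at hx
    rw [Function.iterate_succ_apply']
    induction hx using Submodule.mul_induction_on' with
    | mem_mul_mem t ht y hy => exact apply_mem_actSpan (v := y v) ht (ih y hy v)
    | add x _ y _ hx hy => exact Submodule.add_mem _ hx hy

/-- The span of all products of `n` elements of `T` and one further element, in any order. -/
def wordSpan {R : Type*} [Ring R] [Algebra F R] (T : Submodule F R) : ℕ → Submodule F R
  | 0 => ⊤
  | n + 1 => T * wordSpan T n ⊔ wordSpan T n * T

lemma pow_mul_wordSpan_mul_pow_eq_bot {R : Type*} [Ring R] [Algebra F R] {T : Submodule F R}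
    {k : ℕ} (hT : T ^ k = ⊥) (n : ℕ) :
    ∀ i j, 2 * k ≤ i + j + n → T ^ i * wordSpan T n * T ^ j = ⊥ := by
  induction n with
  | zero =>
    intro i j h
    rcases le_or_gt k i with hi | hi
    · rw [← Nat.add_sub_of_le hi, pow_add, hT]; simp
    · rw [← Nat.add_sub_of_le (show k ≤ j by omega), pow_add, hT]; simp
  | succ n ih =>
    intro i j h
    rw [wordSpan, Submodule.mul_sup, Submodule.sup_mul, ← mul_assoc, ← pow_succ, ← mul_assoc,
      mul_assoc _ T, ← pow_succ', ih _ _ (by omega), ih _ _ (by omega), bot_sup_eq]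

/-- A proper subspace generating a nilpotent algebra is properly contained in its normalizer
with respect to the Jordan product. -/
lemma exists_notMem_jordan_mul_mem {R : Type*} [Ring R] [Algebra F R] {S T : Submodule F R}
    (hS : ∀ a ∈ S, ∀ b ∈ S, a * b + b * a ∈ S) (hTS : T < S) {k : ℕ} (hT : T ^ k = ⊥) :
    ∃ a ∈ S, a ∉ T ∧ ∀ t ∈ T, t * a + a * t ∈ T := by
  by_contra! hcon
  have key : ∀ n, ∃ a ∈ S, a ∉ T ∧ a ∈ wordSpan T n := by
    intro n
    induction n with
    | zero =>
      obtain ⟨a, ha, haT⟩ := SetLike.exists_of_lt hTS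
      exact ⟨a, ha, haT, Submodule.mem_top⟩
    | succ n ih =>
      obtain ⟨a, ha, haT, haw⟩ := ih
      obtain ⟨t, ht, hta⟩ := hcon a ha haT
      exact ⟨_, hS t (hTS.le ht) a ha, hta, Submodule.add_mem_sup
        (Submodule.mul_mem_mul ht haw) (Submodule.mul_mem_mul haw ht)⟩
  obtain ⟨a, -, haT, haw⟩ := key (2 * k)
  have h := pow_mul_wordSpan_mul_pow_eq_bot hT (2 * k) 0 0 (by omega)
  rw [pow_zero, one_mul, mul_one] at h
  rw [h, Submodule.mem_bot] at haw
  exact haT (haw ▸ T.zero_mem)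

/-- Jacobson's theorem on weakly closed sets, for the Jordan product: a space of nilpotent
operators closed under `a * b + b * a` acts nilpotently. -/
theorem exists_iterate_actSpan_eq_bot [FiniteDimensional F V] (S : Submodule F (Module.End F V))
    (hS : ∀ a ∈ S, ∀ b ∈ S, a * b + b * a ∈ S) (hnil : ∀ a ∈ S, IsNilpotent a) :
    ∃ k, (actSpan S)^[k] ⊤ = ⊥ := by
  induction hd : Module.finrank F V using Nat.strong_induction_on generalizing V with
  | _ d ih =>
  subst hd
  -- the stabilizer in `S` of a proper nonzero subspace acts nilpotently
  have stab : ∀ W : Submodule F V, W ≠ ⊥ → W ≠ ⊤ → ∀ D ≤ S,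
      (∀ a ∈ D, ∀ b ∈ D, a * b + b * a ∈ D) → (∀ d ∈ D, ∀ w ∈ W, d w ∈ W) →
      ∃ k, (actSpan D)^[k] ⊤ = ⊥ := by
    intro W hbot htop D hDS hD hDW
    refine exists_iterate_actSpan_of_invariant hDW
      (ih _ (Submodule.finrank_lt htop) _ ?_ ?_ rfl) (ih _ ?_ _ ?_ ?_ rfl)
    · rintro a ⟨x, hx, hax⟩ b ⟨y, hy, hby⟩
      exact ⟨_, hD x hx y hy, fun w => by simp [hax, hby]⟩
    · rintro a ⟨x, hx, hax⟩
      obtain ⟨n, hn⟩ := hnil x (hDS hx)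
      refine ⟨n, LinearMap.ext fun w => Subtype.ext ?_⟩
      have : ∀ m, (((a ^ m) w : W) : V) = (x ^ m) w := by
        intro m
        induction m with
        | zero => simp
        | succ m hm => rw [pow_succ', pow_succ', Module.End.mul_apply, hax, hm]; rfl
      rw [this, hn]; rfl
    · have h := W.finrank_quotient_add_finrank
      have h' : 0 < Module.finrank F W :=
        Nat.pos_of_ne_zero fun h0 => hbot (Submodule.finrank_eq_zero.1 h0)
      omega
    · rintro a ⟨x, hx, hax⟩ b ⟨y, hy, hby⟩
      refine ⟨_, hD x hx y hy, fun w => ?_⟩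
      simp only [LinearMap.add_apply, Module.End.mul_apply, hax, hby, map_add]
    · rintro a ⟨x, hx, hax⟩
      obtain ⟨n, hn⟩ := hnil x (hDS hx)
      refine ⟨n, LinearMap.ext fun w => ?_⟩
      obtain ⟨v, rfl⟩ := W.mkQ_surjective w
      have : ∀ m, (a ^ m) (W.mkQ v) = W.mkQ ((x ^ m) v) := by
        intro m
        induction m with
        | zero => simp
        | succ m hm => rw [pow_succ', pow_succ', Module.End.mul_apply, hm, hax]; rfl
      rw [this, hn]; simp
  let P : Set (Submodule F (Module.End F V)) :=
    {T | T ≤ S ∧ (∀ a ∈ T, ∀ b ∈ T, a * b + b * a ∈ T) ∧ ∃ k, (actSpan T)^[k] ⊤ = ⊥}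
  have hP : P.Nonempty := by
    refine ⟨⊥, bot_le, ?_, 1, ?_⟩
    · intro a ha b hb
      rw [Submodule.mem_bot] at ha hb
      simp [ha, hb]
    · simp [actSpan]
  obtain ⟨T, ⟨hTS, hT, k, hk⟩, hmax⟩ := exists_maximal_of_wellFoundedGT (· ∈ P) hP
  rcases hTS.eq_or_lt with rfl | hlt
  · exact ⟨k, hk⟩
  exfalso
  suffices h : ∃ W : Submodule F V, W ≠ ⊥ ∧ W ≠ ⊤ ∧ (∀ t ∈ T, ∀ w ∈ W, t w ∈ W) ∧
      ∃ a ∈ S, a ∉ T ∧ ∀ w ∈ W, a w ∈ W by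
    obtain ⟨W, hbot, htop, hTW, a, ha, haT, haW⟩ := h
    let D : Submodule F (Module.End F V) :=
      { carrier := {s | s ∈ S ∧ ∀ w ∈ W, s w ∈ W}
        add_mem' := fun hx hy => ⟨S.add_mem hx.1 hy.1,
          fun w hw => W.add_mem (hx.2 w hw) (hy.2 w hw)⟩
        zero_mem' := ⟨S.zero_mem, fun w _ => W.zero_mem⟩
        smul_mem' := fun r x hx => ⟨S.smul_mem r hx.1, fun w hw => W.smul_mem r (hx.2 w hw)⟩ }
    have hDS : D ≤ S := fun s hs => hs.1
    have hD : ∀ a ∈ D, ∀ b ∈ D, a * b + b * a ∈ D := fun a ha b hb =>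
      ⟨hS a ha.1 b hb.1, fun w hw =>
        W.add_mem (ha.2 _ (hb.2 w hw)) (hb.2 _ (ha.2 w hw))⟩
    have hDP : D ∈ P := ⟨hDS, hD, stab W hbot htop D hDS hD fun d hd => hd.2⟩
    exact haT (hmax hDP (fun t ht => ⟨hTS ht, hTW t ht⟩) ⟨ha, haW⟩)
  have hVne : Nontrivial V := by
    obtain ⟨a, -, haT⟩ := SetLike.exists_of_lt hlt
    obtain ⟨v, hv⟩ : ∃ v, a v ≠ 0 := by
      by_contra! h
      exact haT ((LinearMap.ext h : a = 0) ▸ T.zero_mem)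
    exact ⟨a v, 0, hv⟩
  by_cases hT0 : T = ⊥
  · obtain ⟨a, ha, haT⟩ := SetLike.exists_of_lt hlt
    refine ⟨LinearMap.ker a, ?_, ?_, ?_, a, ha, haT, ?_⟩
    · intro hker
      obtain ⟨n, hn⟩ := hnil a ha
      obtain ⟨v, hv⟩ := exists_ne (0 : V)
      have hinj : Function.Injective (a ^ n) := by
        rw [Module.End.coe_pow]
        exact (LinearMap.ker_eq_bot.1 hker).iterate n
      exact hv (hinj (by rw [hn]; simp))
    · intro hker
      rw [hT0, Submodule.mem_bot] at haT
      exact haT (LinearMap.ker_eq_top.1 hker)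
    · intro t ht w _
      rw [hT0, Submodule.mem_bot] at ht
      simp [ht]
    · intro w hw
      rw [LinearMap.mem_ker.1 hw]
      exact Submodule.zero_mem _
  · let W : Submodule F V :=
      { carrier := {v | ∀ t ∈ T, t v = 0}
        add_mem' := fun hx hy t ht => by rw [map_add, hx t ht, hy t ht, add_zero]
        zero_mem' := fun t _ => map_zero t
        smul_mem' := fun r x hx t ht => by rw [map_smul, hx t ht, smul_zero] }
    have hTk : T ^ k = ⊥ := by
      refine eq_bot_iff.2 fun x hx => ?_
      have h := apply_mem_iterate_actSpan T k x hx
      rw [hk] at h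
      exact LinearMap.ext h
    obtain ⟨a, ha, haT, haj⟩ := exists_notMem_jordan_mul_mem hS hlt hTk
    refine ⟨W, ?_, ?_, ?_, a, ha, haT, ?_⟩
    · intro hW
      have hstep : ∀ n, (actSpan T)^[n] ⊤ ≠ ⊥ := by
        intro n
        induction n with
        | zero => simp
        | succ n hn =>
          intro h0
          refine hn (eq_bot_iff.2 (hW ▸ fun v hv t ht => ?_))
          rw [← Submodule.mem_bot F, ← h0, Function.iterate_succ_apply']
          exact apply_mem_actSpan ht hv
      exact hstep k hk
    · intro hW
      refine hT0 (eq_bot_iff.2 fun t ht => LinearMap.ext fun v => ?_)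
      exact (hW ▸ Submodule.mem_top : v ∈ W) t ht
    · intro t ht w hw
      rw [hw t ht]
      exact W.zero_mem
    · intro w hw t ht
      have h := hw _ (haj t ht)
      rwa [LinearMap.add_apply, Module.End.mul_apply, Module.End.mul_apply, hw t ht, map_zero,
        add_zero] at h

end Engel

section Alternative

variable {F U : Type*} [Field F] [NonUnitalNonAssocRing U]

/-- The left and right alternative laws. -/
def IsAlternativeRing (U : Type*) [NonUnitalNonAssocRing U] : Prop :=
  ∀ x y : U, (x * x) * y = x * (x * y) ∧ (y * x) * x = y * (x * x)

namespace IsAlternativeRing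

variable (h : IsAlternativeRing U)
include h

lemma mul_mul_add_left_swap (x y z : U) :
    x * y * z + y * x * z = x * (y * z) + y * (x * z) := by
  have h1 := (h (x + y) z).1
  simp only [add_mul, mul_add, (h x z).1, (h y z).1] at h1
  have h2 : x * y * z + y * x * z - (x * (y * z) + y * (x * z)) = 0 := by
    rw [← sub_eq_zero] at h1
    rw [← h1]; abel
  exact sub_eq_zero.1 h2

lemma mul_mul_add_right_swap (x y z : U) :
    x * y * z + x * z * y = x * (y * z) + x * (z * y) := by
  have h1 := (h (y + z) x).2
  simp only [add_mul, mul_add, (h y x).2, (h z x).2] at h1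
  have h2 : x * y * z + x * z * y - (x * (y * z) + x * (z * y)) = 0 := by
    rw [← sub_eq_zero] at h1
    rw [← h1]; abel
  exact sub_eq_zero.1 h2

lemma flexible (x y : U) : x * y * x = x * (y * x) := by
  have h1 := h.mul_mul_add_left_swap x y x
  rw [(h x y).2, add_comm (x * (y * x))] at h1
  exact add_right_cancel (h1.trans (add_comm _ _))

lemma lpow_mul_self (x : U) (n : ℕ) : lpow x n * x = x * lpow x n := by
  induction n with
  | zero => rfl
  | succ n ih => rw [lpow, h.flexible, ih]

/-- Left multiplication by `x ^ (n + 1)` is the `(n + 1)`-st iterate of left multiplication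
by `x`. -/
lemma lpow_mul (h2 : ∀ u : U, u + u = 0 → u = 0) (x : U) (n : ℕ) (y : U) :
    lpow x n * y = (fun z => x * z)^[n + 1] y := by
  induction n generalizing y with
  | zero => rfl
  | succ n ih =>
    have h1 := h.mul_mul_add_left_swap x (lpow x n) y
    rw [h.lpow_mul_self, ih, ih, ← Function.iterate_succ_apply (fun z => x * z) (n + 1),
      ← Function.iterate_succ_apply' (fun z => x * z) (n + 1)] at h1
    refine sub_eq_zero.1 (h2 _ ?_)
    rw [← sub_eq_zero] at h1
    rw [← h1, lpow]; abel

lemma lpow_mul_lpow (h2 : ∀ u : U, u + u = 0 → u = 0) (x : U) (n m : ℕ) :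
    lpow x n * lpow x m = lpow x (n + m + 1) := by
  have aux : ∀ k, lpow x k = (fun z => x * z)^[k] x := by
    intro k
    induction k with
    | zero => rfl
    | succ k ih => rw [Function.iterate_succ_apply', ← ih, lpow]
  rw [h.lpow_mul h2, aux m, aux, ← Function.iterate_add_apply,
    Nat.add_right_comm]

lemma isNilElem_of_mul_self (h2 : ∀ u : U, u + u = 0 → u = 0) {x : U}
    (hx : IsNilElem (x * x)) : IsNilElem x := by
  obtain ⟨n, hn⟩ := hx
  have aux : ∀ k, lpow (x * x) k = lpow x (2 * k + 1) := by
    intro k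
    induction k with
    | zero => rfl
    | succ k ih =>
      rw [lpow, ih, show x * x = lpow x 1 from rfl, h.lpow_mul_lpow h2]
      congr 1
      omega
  exact ⟨_, (aux n).symm.trans hn⟩

end IsAlternativeRing

variable [Module F U]

/-- The multiplication rules of a Peirce decomposition `U = A ⊕ B ⊕ C ⊕ D`, where
`A`, `B`, `C`, `D` play the roles of `U₁₁`, `U₁₀`, `U₀₁`, `U₀₀`. -/
structure IsPeirce (A B C D : Submodule F U) : Prop where
  aa : ∀ x ∈ A, ∀ y ∈ A, x * y ∈ A
  ab : ∀ x ∈ A, ∀ y ∈ B, x * y ∈ B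
  ac : ∀ x ∈ A, ∀ y ∈ C, x * y = 0
  ad : ∀ x ∈ A, ∀ y ∈ D, x * y = 0
  ba : ∀ x ∈ B, ∀ y ∈ A, x * y = 0
  bb : ∀ x ∈ B, ∀ y ∈ B, x * y ∈ C
  bc : ∀ x ∈ B, ∀ y ∈ C, x * y ∈ A
  bd : ∀ x ∈ B, ∀ y ∈ D, x * y ∈ B
  ca : ∀ x ∈ C, ∀ y ∈ A, x * y ∈ C
  cb : ∀ x ∈ C, ∀ y ∈ B, x * y ∈ D
  cc : ∀ x ∈ C, ∀ y ∈ C, x * y ∈ B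
  cd : ∀ x ∈ C, ∀ y ∈ D, x * y = 0
  da : ∀ x ∈ D, ∀ y ∈ A, x * y = 0
  db : ∀ x ∈ D, ∀ y ∈ B, x * y = 0
  dc : ∀ x ∈ D, ∀ y ∈ C, x * y ∈ C
  dd : ∀ x ∈ D, ∀ y ∈ D, x * y ∈ D
  sup_eq_top : A ⊔ B ⊔ C ⊔ D = ⊤

namespace IsPeirce

lemma swap {A B C D : Submodule F U} (P : IsPeirce A B C D) : IsPeirce D C B A :=
  ⟨P.dd, P.dc, P.db, P.da, P.cd, P.cc, P.cb, P.ca, P.bd, P.bc, P.bb, P.ba, P.ad, P.ac, P.ab, P.aa,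
    by rw [← P.sup_eq_top]; ac_rfl⟩

section Identities

variable {A B C D : Submodule F U} (P : IsPeirce A B C D) (h : IsAlternativeRing U)
include P h

lemma assoc_aab {a a' b : U} (ha : a ∈ A) (ha' : a' ∈ A) (hb : b ∈ B) :
    a * (a' * b) = a * a' * b := by
  have := h.mul_mul_add_right_swap a a' b
  simpa [P.ba _ (P.ab a ha b hb) a' ha', P.ba b hb a' ha'] using this.symm

lemma assoc_caa {c a a' : U} (hc : c ∈ C) (ha : a ∈ A) (ha' : a' ∈ A) :
    c * a * a' = c * (a * a') := by
  have := h.mul_mul_add_left_swap c a a'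
  simpa [P.ac a ha c hc, P.ac a ha _ (P.ca c hc a' ha')] using this

lemma abb_eq {a b b' : U} (ha : a ∈ A) (hb : b ∈ B) (hb' : b' ∈ B) :
    a * b * b' = b * (a * b') := by
  have := h.mul_mul_add_left_swap a b b'
  simpa [P.ba b hb a ha, P.ac a ha _ (P.bb b hb b' hb')] using this

lemma bab_eq {a b b' : U} (ha : a ∈ A) (hb : b ∈ B) (hb' : b' ∈ B) :
    b * (a * b') = b * b' * a := by
  have := h.mul_mul_add_right_swap b b' a
  simpa [P.ba b hb a ha, P.ba b' hb' a ha] using this.symm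

lemma cca_eq {a c c' : U} (ha : a ∈ A) (hc : c ∈ C) (hc' : c' ∈ C) :
    c' * (c * a) = c' * a * c := by
  have := h.mul_mul_add_right_swap c' c a
  simpa [P.ac a ha c hc, P.ba _ (P.cc c' hc' c hc) a ha] using this.symm

lemma cac_eq {a c c' : U} (ha : a ∈ A) (hc : c ∈ C) (hc' : c' ∈ C) :
    c' * a * c = a * (c' * c) := by
  have := h.mul_mul_add_left_swap c' a c
  simpa [P.ac a ha c hc, P.ac a ha c' hc'] using this

lemma assoc_cab {a b c : U} (ha : a ∈ A) (hb : b ∈ B) (hc : c ∈ C) :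
    c * a * b = c * (a * b) := by
  have := h.mul_mul_add_left_swap c a b
  simpa [P.ac a ha c hc, P.ad a ha _ (P.cb c hc b hb)] using this

lemma assoc_bca {a b c : U} (ha : a ∈ A) (hb : b ∈ B) (hc : c ∈ C) :
    b * (c * a) = b * c * a := by
  have := h.mul_mul_add_right_swap b c a
  simpa [P.ac a ha c hc, P.ba b hb a ha] using this.symm

lemma assoc_abc {a b c : U} (ha : a ∈ A) (hb : b ∈ B) (hc : c ∈ C) :
    a * b * c = a * (b * c) := by
  have := h.mul_mul_add_left_swap a b c
  simpa [P.ac a ha c hc, P.ba b hb a ha] using this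

lemma assoc_abd {a b d : U} (ha : a ∈ A) (hb : b ∈ B) (hd : d ∈ D) :
    a * b * d = a * (b * d) := by
  have := h.mul_mul_add_left_swap a b d
  simpa [P.ad a ha d hd, P.ba b hb a ha] using this

lemma assoc_dca {a c d : U} (ha : a ∈ A) (hc : c ∈ C) (hd : d ∈ D) :
    d * (c * a) = d * c * a := by
  have := h.mul_mul_add_right_swap d c a
  simpa [P.ac a ha c hc, P.da d hd a ha] using this.symm

lemma assoc_dcb {b c d : U} (hb : b ∈ B) (hc : c ∈ C) (hd : d ∈ D) :
    d * (c * b) = d * c * b := by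
  have := h.mul_mul_add_left_swap d c b
  simpa [P.cd c hc d hd, P.db d hd b hb] using this.symm

lemma assoc_cbd {b c d : U} (hb : b ∈ B) (hc : c ∈ C) (hd : d ∈ D) :
    c * b * d = c * (b * d) := by
  have := h.mul_mul_add_right_swap c b d
  simpa [P.cd c hc d hd, P.db d hd b hb] using this

lemma bcb_eq {b b' c : U} (hb : b ∈ B) (hb' : b' ∈ B) (hc : c ∈ C) :
    b * (c * b') = b * c * b' + b * b' * c := by
  have := h.mul_mul_add_right_swap b c b'
  simpa [P.ba b hb _ (P.bc b' hb' c hc)] using this.symm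

lemma cbc_eq {b c c' : U} (hb : b ∈ B) (hc : c ∈ C) (hc' : c' ∈ C) :
    c * b * c' = c * (b * c') - c * c' * b := by
  have := h.mul_mul_add_right_swap c b c'
  rw [P.cd c hc _ (P.cb c' hc' b hb), add_zero] at this
  exact eq_sub_of_add_eq this

end Identities

end IsPeirce

variable [SMulCommClass F U U] [IsScalarTower F U U]

/-- The span of the products `x * y` with `x ∈ p` and `y ∈ q`. -/
def mulSpan (p q : Submodule F U) : Submodule F U :=
  Submodule.map₂ (LinearMap.mul F U) p q

lemma mulSpan_le {p q r : Submodule F U} :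
    mulSpan p q ≤ r ↔ ∀ x ∈ p, ∀ y ∈ q, x * y ∈ r :=
  Submodule.map₂_le

lemma mul_mem_mulSpan {p q : Submodule F U} {x y : U} (hx : x ∈ p) (hy : y ∈ q) :
    x * y ∈ mulSpan p q :=
  Submodule.apply_mem_map₂ _ hx hy

lemma mul_mem_of_mem_mulSpan {p q r : Submodule F U} {x y : U} (hx : x ∈ mulSpan p q)
    (h : ∀ u ∈ p, ∀ v ∈ q, u * v * y ∈ r) : x * y ∈ r :=
  (mulSpan_le (r := r.comap (LinearMap.mulRight F y))).2 h hx

lemma mem_mul_of_mem_mulSpan {p q r : Submodule F U} {x y : U} (hx : x ∈ mulSpan p q)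
    (h : ∀ u ∈ p, ∀ v ∈ q, y * (u * v) ∈ r) : y * x ∈ r :=
  (mulSpan_le (r := r.comap (LinearMap.mulLeft F y))).2 h hx

/-- A nonzero finite-dimensional nil alternative algebra is different from its square. -/
theorem eq_bot_of_le_mulSpan_self [FiniteDimensional F U] (h : IsAlternativeRing U)
    (h2 : ∀ u : U, u + u = 0 → u = 0) {M : Submodule F U}
    (hM : mulSpan M M ≤ M) (hnil : ∀ x ∈ M, IsNilElem x) (hsq : M ≤ mulSpan M M) : M = ⊥ := by
  obtain ⟨k, hk⟩ := exists_iterate_actSpan_eq_bot (M.map (LinearMap.mul F U)) (by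
    rintro _ ⟨x, hx, rfl⟩ _ ⟨y, hy, rfl⟩
    refine ⟨x * y + y * x, M.add_mem (mulSpan_le.1 hM x hx y hy) (mulSpan_le.1 hM y hy x hx), ?_⟩
    ext z
    simpa [add_mul] using h.mul_mul_add_left_swap x y z) (by
    rintro _ ⟨x, hx, rfl⟩
    obtain ⟨n, hn⟩ := hnil x hx
    refine ⟨n + 1, LinearMap.ext fun y => ?_⟩
    have h1 := h.lpow_mul h2 x n y
    rw [hn, zero_mul] at h1
    rw [Module.End.pow_apply]
    exact h1.symm)
  refine eq_bot_iff.2 (hk ▸ ?_)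
  clear hk
  induction k with
  | zero => exact le_top
  | succ k ih =>
    rw [Function.iterate_succ_apply']
    exact hsq.trans (mulSpan_le.2 fun x hx y hy => apply_mem_actSpan
      (t := LinearMap.mul F U x) ⟨x, hx, rfl⟩ (ih hy))

lemma mulSpan_mono {p p' q q' : Submodule F U} (hp : p ≤ p') (hq : q ≤ q') :
    mulSpan p q ≤ mulSpan p' q' :=
  Submodule.map₂_le_map₂ hp hq

lemma mulSpan_sup_left (p p' q : Submodule F U) :
    mulSpan (p ⊔ p') q = mulSpan p q ⊔ mulSpan p' q :=
  Submodule.map₂_sup_left _ _ _ _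

lemma mulSpan_sup_right (p q q' : Submodule F U) :
    mulSpan p (q ⊔ q') = mulSpan p q ⊔ mulSpan p q' :=
  Submodule.map₂_sup_right _ _ _ _

lemma mulSpan_le_of_mul_eq_zero {p q r : Submodule F U} (h : ∀ x ∈ p, ∀ y ∈ q, x * y = 0) :
    mulSpan p q ≤ r :=
  mulSpan_le.2 fun x hx y hy => h x hx y hy ▸ r.zero_mem

/-- The square of an ideal `M` of a subalgebra `A` is an ideal of `A`. -/
lemma mulSpan_self_ideal (h : IsAlternativeRing U) {A M : Submodule F U}
    (hI : ∀ x ∈ M, ∀ y ∈ A, y * x ∈ M ∧ x * y ∈ M) :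
    ∀ x ∈ mulSpan M M, ∀ y ∈ A, y * x ∈ mulSpan M M ∧ x * y ∈ mulSpan M M := by
  refine fun x hx y hy => ⟨mem_mul_of_mem_mulSpan hx fun u hu v hv => ?_,
    mul_mem_of_mem_mulSpan hx fun u hu v hv => ?_⟩
  · rw [eq_sub_of_add_eq' (h.mul_mul_add_left_swap u y v).symm]
    exact Submodule.sub_mem _ (Submodule.add_mem _ (mul_mem_mulSpan (hI u hu y hy).2 hv)
      (mul_mem_mulSpan (hI u hu y hy).1 hv)) (mul_mem_mulSpan hu (hI v hv y hy).1)
  · rw [eq_sub_of_add_eq (h.mul_mul_add_right_swap u v y)]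
    exact Submodule.sub_mem _ (Submodule.add_mem _ (mul_mem_mulSpan hu (hI v hv y hy).2)
      (mul_mem_mulSpan hu (hI v hv y hy).1)) (mul_mem_mulSpan (hI u hu y hy).2 hv)

/-- The ideal of `U` generated by an ideal `M` of the Peirce component `A`. -/
def peirceIdeal (B C M : Submodule F U) : Submodule F U :=
  M ⊔ mulSpan M B ⊔ mulSpan C M ⊔ mulSpan C (mulSpan M B)

namespace IsPeirce

section Ideal

variable {A B C D M : Submodule F U} (P : IsPeirce A B C D)

include P in
lemma mulSpan_ab_le (hM : M ≤ A) : mulSpan M B ≤ B :=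
  mulSpan_le.2 fun x hx => P.ab x (hM hx)

include P in
lemma mulSpan_ca_le (hM : M ≤ A) : mulSpan C M ≤ C :=
  mulSpan_le.2 fun x hx y hy => P.ca x hx y (hM hy)

include P in
lemma mulSpan_cab_le (hM : M ≤ A) : mulSpan C (mulSpan M B) ≤ D :=
  mulSpan_le.2 fun x hx y hy => P.cb x hx y (P.mulSpan_ab_le hM hy)

variable (h : IsAlternativeRing U) (hM : M ≤ A)
  (hI : ∀ x ∈ M, ∀ y ∈ A, y * x ∈ M ∧ x * y ∈ M) {x y : U}
include P h hM

lemma b_mul_mem (hx : x ∈ mulSpan M B) (hy : y ∈ B) : y * x ∈ mulSpan C M :=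
  mem_mul_of_mem_mulSpan hx fun m hm b hb => by
    rw [P.bab_eq h (hM hm) hy hb]
    exact mul_mem_mulSpan (P.bb y hy b hb) hm

lemma mul_b_mem (hx : x ∈ mulSpan M B) (hy : y ∈ B) : x * y ∈ mulSpan C M :=
  mul_mem_of_mem_mulSpan hx fun m hm b hb => by
    rw [P.abb_eq h (hM hm) hb hy, P.bab_eq h (hM hm) hb hy]
    exact mul_mem_mulSpan (P.bb b hb y hy) hm

lemma mul_d_mem (hx : x ∈ mulSpan M B) (hy : y ∈ D) : x * y ∈ mulSpan M B :=
  mul_mem_of_mem_mulSpan hx fun m hm b hb => by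
    rw [P.assoc_abd h (hM hm) hb hy]
    exact mul_mem_mulSpan hm (P.bd b hb y hy)

lemma c_mul_mem (hx : x ∈ mulSpan C M) (hy : y ∈ C) : y * x ∈ mulSpan M B :=
  mem_mul_of_mem_mulSpan hx fun c hc m hm => by
    rw [P.cca_eq h (hM hm) hc hy, P.cac_eq h (hM hm) hc hy]
    exact mul_mem_mulSpan hm (P.cc y hy c hc)

lemma mul_c_mem (hx : x ∈ mulSpan C M) (hy : y ∈ C) : x * y ∈ mulSpan M B :=
  mul_mem_of_mem_mulSpan hx fun c hc m hm => by
    rw [P.cac_eq h (hM hm) hy hc]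
    exact mul_mem_mulSpan hm (P.cc c hc y hy)

lemma d_mul_mem (hx : x ∈ mulSpan C M) (hy : y ∈ D) : y * x ∈ mulSpan C M :=
  mem_mul_of_mem_mulSpan hx fun c hc m hm => by
    rw [P.assoc_dca h (hM hm) hc hy]
    exact mul_mem_mulSpan (P.dc y hy c hc) hm

lemma ca_mul_b_mem (hx : x ∈ mulSpan C M) (hy : y ∈ B) : x * y ∈ mulSpan C (mulSpan M B) :=
  mul_mem_of_mem_mulSpan hx fun c hc m hm => by
    rw [P.assoc_cab h (hM hm) hy hc]
    exact mul_mem_mulSpan hc (mul_mem_mulSpan hm hy)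

lemma cab_mul_d_mem (hx : x ∈ mulSpan C (mulSpan M B)) (hy : y ∈ D) :
    x * y ∈ mulSpan C (mulSpan M B) :=
  mul_mem_of_mem_mulSpan hx fun c hc b hb => by
    rw [P.assoc_cbd h (P.mulSpan_ab_le hM hb) hc hy]
    exact mul_mem_mulSpan hc (P.mul_d_mem h hM hb hy)

lemma d_mul_cab_mem (hx : x ∈ mulSpan C (mulSpan M B)) (hy : y ∈ D) :
    y * x ∈ mulSpan C (mulSpan M B) :=
  mem_mul_of_mem_mulSpan hx fun c hc b hb => by
    rw [P.assoc_dcb h (P.mulSpan_ab_le hM hb) hc hy]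
    exact mul_mem_mulSpan (P.dc y hy c hc) hb

/-- For `M ≤ A` and `K ≤ A`, `M (K B) ⊆ (M K) B`. -/
lemma a_mul_ab_mem {K : Submodule F U} (hK : K ≤ A) (hx : x ∈ mulSpan K B) (hy : y ∈ M) :
    y * x ∈ mulSpan (mulSpan M K) B :=
  mem_mul_of_mem_mulSpan hx fun k hk b hb => by
    rw [P.assoc_aab h (hM hy) (hK hk) hb]
    exact mul_mem_mulSpan (mul_mem_mulSpan hy hk) hb

/-- For `M ≤ A` and `K ≤ A`, `(C M) K ⊆ C (M K)`. -/
lemma ca_mul_a_mem {K : Submodule F U} (hK : K ≤ A) (hx : x ∈ mulSpan C M) (hy : y ∈ K) :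
    x * y ∈ mulSpan C (mulSpan M K) :=
  mul_mem_of_mem_mulSpan hx fun c hc m hm => by
    rw [P.assoc_caa h hc (hM hm) (hK hy)]
    exact mul_mem_mulSpan hc (mul_mem_mulSpan hm hy)

include hI

lemma mul_c_mem_self (hx : x ∈ mulSpan M B) (hy : y ∈ C) : x * y ∈ M :=
  mul_mem_of_mem_mulSpan hx fun m hm b hb => by
    rw [P.assoc_abc h (hM hm) hb hy]
    exact (hI m hm _ (P.bc b hb y hy)).2

lemma b_mul_mem_self (hx : x ∈ mulSpan C M) (hy : y ∈ B) : y * x ∈ M :=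
  mem_mul_of_mem_mulSpan hx fun c hc m hm => by
    rw [P.assoc_bca h (hM hm) hy hc]
    exact (hI m hm _ (P.bc y hy c hc)).1

lemma a_mul_mem (hx : x ∈ mulSpan M B) (hy : y ∈ A) : y * x ∈ mulSpan M B :=
  mulSpan_mono (mulSpan_le.2 fun a ha m hm => (hI m hm a ha).1) le_rfl
    (P.a_mul_ab_mem h le_rfl hM hx hy)

lemma mul_a_mem (hx : x ∈ mulSpan C M) (hy : y ∈ A) : x * y ∈ mulSpan C M :=
  mulSpan_mono le_rfl (mulSpan_le.2 fun m hm a ha => (hI m hm a ha).2)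
    (P.ca_mul_a_mem h hM le_rfl hx hy)

lemma cab_mul_c_mem (hx : x ∈ mulSpan C (mulSpan M B)) (hy : y ∈ C) : x * y ∈ mulSpan C M :=
  mul_mem_of_mem_mulSpan hx fun c hc b hb => by
    rw [P.cbc_eq h (P.mulSpan_ab_le hM hb) hc hy]
    exact Submodule.sub_mem _ (mul_mem_mulSpan hc (P.mul_c_mem_self h hM hI hb hy))
      (P.b_mul_mem h hM hb (P.cc c hc y hy))

lemma b_mul_cab_mem (hx : x ∈ mulSpan C (mulSpan M B)) (hy : y ∈ B) : y * x ∈ mulSpan M B :=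
  mem_mul_of_mem_mulSpan hx fun c hc b hb => by
    rw [P.bcb_eq h hy (P.mulSpan_ab_le hM hb) hc]
    exact Submodule.add_mem _ (P.a_mul_mem h hM hI hb (P.bc y hy c hc))
      (P.mul_c_mem h hM (P.b_mul_mem h hM hb hy) hc)

theorem peirceIdeal_ideal :
    ∀ x ∈ peirceIdeal B C M, ∀ y, y * x ∈ peirceIdeal B C M ∧ x * y ∈ peirceIdeal B C M := by
  have h1 : M ≤ peirceIdeal B C M := le_sup_left.trans (le_sup_left.trans le_sup_left)
  have hX : mulSpan M B ≤ peirceIdeal B C M :=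
    le_sup_right.trans (le_sup_left.trans le_sup_left)
  have hY : mulSpan C M ≤ peirceIdeal B C M := le_sup_right.trans le_sup_left
  have hZ : mulSpan C (mulSpan M B) ≤ peirceIdeal B C M := le_sup_right
  have hXB := P.mulSpan_ab_le hM
  have hYC := P.mulSpan_ca_le hM
  have hZD := P.mulSpan_cab_le hM
  have hl : mulSpan (A ⊔ B ⊔ C ⊔ D) (peirceIdeal B C M) ≤ peirceIdeal B C M := by
    conv_lhs => rw [peirceIdeal]
    simp only [mulSpan_sup_left, mulSpan_sup_right, sup_le_iff]
    exact ⟨⟨⟨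
      ⟨⟨⟨(mulSpan_le.2 fun y hy x hx => (hI x hx y hy).1).trans h1,
          mulSpan_le_of_mul_eq_zero fun y hy x hx => P.ba y hy x (hM hx)⟩, hY⟩,
        mulSpan_le_of_mul_eq_zero fun y hy x hx => P.da y hy x (hM hx)⟩,
      ⟨⟨(mulSpan_le.2 fun y hy x hx => P.a_mul_mem h hM hI hx hy).trans hX,
          (mulSpan_le.2 fun y hy x hx => P.b_mul_mem h hM hx hy).trans hY⟩, hZ⟩,
        mulSpan_le_of_mul_eq_zero fun y hy x hx => P.db y hy x (hXB hx)⟩,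
      ⟨⟨mulSpan_le_of_mul_eq_zero fun y hy x hx => P.ac y hy x (hYC hx),
          (mulSpan_le.2 fun y hy x hx => P.b_mul_mem_self h hM hI hx hy).trans h1⟩,
          (mulSpan_le.2 fun y hy x hx => P.c_mul_mem h hM hx hy).trans hX⟩,
        (mulSpan_le.2 fun y hy x hx => P.d_mul_mem h hM hx hy).trans hY⟩,
      ⟨⟨mulSpan_le_of_mul_eq_zero fun y hy x hx => P.ad y hy x (hZD hx),
          (mulSpan_le.2 fun y hy x hx => P.b_mul_cab_mem h hM hI hx hy).trans hX⟩,
          mulSpan_le_of_mul_eq_zero fun y hy x hx => P.cd y hy x (hZD hx)⟩,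
        (mulSpan_le.2 fun y hy x hx => P.d_mul_cab_mem h hM hx hy).trans hZ⟩
  have hr : mulSpan (peirceIdeal B C M) (A ⊔ B ⊔ C ⊔ D) ≤ peirceIdeal B C M := by
    conv_lhs => rw [peirceIdeal]
    simp only [mulSpan_sup_left, mulSpan_sup_right, sup_le_iff]
    exact ⟨⟨⟨
      ⟨⟨⟨(mulSpan_le.2 fun x hx y hy => (hI x hx y hy).2).trans h1,
          mulSpan_le_of_mul_eq_zero fun x hx => P.ba x (hXB hx)⟩,
          (mulSpan_le.2 fun x hx y hy => P.mul_a_mem h hM hI hx hy).trans hY⟩,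
        mulSpan_le_of_mul_eq_zero fun x hx => P.da x (hZD hx)⟩,
      ⟨⟨hX, (mulSpan_le.2 fun x hx y hy => P.mul_b_mem h hM hx hy).trans hY⟩,
          (mulSpan_le.2 fun x hx y hy => P.ca_mul_b_mem h hM hx hy).trans hZ⟩,
        mulSpan_le_of_mul_eq_zero fun x hx => P.db x (hZD hx)⟩,
      ⟨⟨mulSpan_le_of_mul_eq_zero fun x hx => P.ac x (hM hx),
          (mulSpan_le.2 fun x hx y hy => P.mul_c_mem_self h hM hI hx hy).trans h1⟩,
          (mulSpan_le.2 fun x hx y hy => P.mul_c_mem h hM hx hy).trans hX⟩,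
        (mulSpan_le.2 fun x hx y hy => P.cab_mul_c_mem h hM hI hx hy).trans hY⟩,
      ⟨⟨mulSpan_le_of_mul_eq_zero fun x hx => P.ad x (hM hx),
          (mulSpan_le.2 fun x hx y hy => P.mul_d_mem h hM hx hy).trans hX⟩,
          mulSpan_le_of_mul_eq_zero fun x hx => P.cd x (hYC hx)⟩,
        (mulSpan_le.2 fun x hx y hy => P.cab_mul_d_mem h hM hx hy).trans hZ⟩
  rw [P.sup_eq_top] at hl hr
  exact fun x hx y => ⟨mulSpan_le.1 hl y Submodule.mem_top x hx,
    mulSpan_le.1 hr x hx y Submodule.mem_top⟩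

theorem mulSpan_peirceIdeal_le :
    mulSpan (peirceIdeal B C M) (peirceIdeal B C M) ≤ peirceIdeal B C (mulSpan M M) := by
  have hMM : mulSpan M M ≤ M := mulSpan_le.2 fun x hx y hy => (hI y hy x (hM hx)).1
  have hM2 := hMM.trans hM
  have hI2 := mulSpan_self_ideal h hI
  set K := mulSpan M M
  have h1 : K ≤ peirceIdeal B C K := le_sup_left.trans (le_sup_left.trans le_sup_left)
  have hX : mulSpan K B ≤ peirceIdeal B C K :=
    le_sup_right.trans (le_sup_left.trans le_sup_left)
  have hY : mulSpan C K ≤ peirceIdeal B C K := le_sup_right.trans le_sup_left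
  have hZ : mulSpan C (mulSpan K B) ≤ peirceIdeal B C K := le_sup_right
  have hXB := P.mulSpan_ab_le hM
  have hYC := P.mulSpan_ca_le hM
  have hZD := P.mulSpan_cab_le hM
  have hXX : ∀ x ∈ mulSpan M B, ∀ y ∈ mulSpan M B, x * y ∈ mulSpan C K :=
    fun x hx y hy => mem_mul_of_mem_mulSpan hy fun m hm b hb => by
      rw [P.bab_eq h (hM hm) (hXB hx) hb]
      exact P.ca_mul_a_mem h hM hM (P.mul_b_mem h hM hx hb) hm
  have hXZ : ∀ x ∈ mulSpan M B, ∀ y ∈ mulSpan C (mulSpan M B), x * y ∈ mulSpan K B :=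
    fun x hx y hy => mem_mul_of_mem_mulSpan hy fun c hc b hb => by
      rw [P.bcb_eq h (hXB hx) (hXB hb) hc]
      exact Submodule.add_mem _
        (P.a_mul_ab_mem h hM hM hb (P.mul_c_mem_self h hM hI hx hc))
        (P.mul_c_mem h hM2 (hXX x hx b hb) hc)
  have hYY : ∀ x ∈ mulSpan C M, ∀ y ∈ mulSpan C M, x * y ∈ mulSpan K B :=
    fun x hx y hy => mem_mul_of_mem_mulSpan hy fun c hc m hm => by
      rw [P.cca_eq h (hM hm) hc (hYC hx), P.cac_eq h (hM hm) hc (hYC hx)]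
      exact P.a_mul_ab_mem h hM hM (P.mul_c_mem h hM hx hc) hm
  have hXY : ∀ x ∈ mulSpan M B, ∀ y ∈ mulSpan C M, x * y ∈ K :=
    fun x hx y hy => mul_mem_of_mem_mulSpan hx fun m hm b hb => by
      rw [P.assoc_abc h (hM hm) hb (hYC hy)]
      exact mul_mem_mulSpan hm (P.b_mul_mem_self h hM hI hy hb)
  have hYX : ∀ x ∈ mulSpan C M, ∀ y ∈ mulSpan M B, x * y ∈ mulSpan C (mulSpan K B) :=
    fun x hx y hy => mul_mem_of_mem_mulSpan hx fun c hc m hm => by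
      rw [P.assoc_cab h (hM hm) (hXB hy) hc]
      exact mul_mem_mulSpan hc (P.a_mul_ab_mem h hM hM hy hm)
  have hZY : ∀ x ∈ mulSpan C (mulSpan M B), ∀ y ∈ mulSpan C M, x * y ∈ mulSpan C K :=
    fun x hx y hy => mul_mem_of_mem_mulSpan hx fun c hc b hb => by
      rw [P.cbc_eq h (hXB hb) hc (hYC hy)]
      exact Submodule.sub_mem _ (mul_mem_mulSpan hc (hXY b hb y hy))
        (hXX _ (P.c_mul_mem h hM hy hc) b hb)
  have hZZ : ∀ x ∈ mulSpan C (mulSpan M B), ∀ y ∈ mulSpan C (mulSpan M B),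
      x * y ∈ mulSpan C (mulSpan K B) :=
    fun x hx y hy => mul_mem_of_mem_mulSpan hx fun c hc b hb => by
      rw [P.assoc_cbd h (hXB hb) hc (hZD hy)]
      exact mul_mem_mulSpan hc (hXZ b hb y hy)
  rw [peirceIdeal]
  simp only [mulSpan_sup_left, mulSpan_sup_right, sup_le_iff]
  exact ⟨⟨⟨
    ⟨⟨⟨h1, mulSpan_le_of_mul_eq_zero fun x hx y hy => P.ba x (hXB hx) y (hM hy)⟩,
        (mulSpan_le.2 fun x hx y hy => P.ca_mul_a_mem h hM hM hx hy).trans hY⟩,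
      mulSpan_le_of_mul_eq_zero fun x hx y hy => P.da x (hZD hx) y (hM hy)⟩,
    ⟨⟨(mulSpan_le.2 fun x hx y hy => P.a_mul_ab_mem h hM hM hy hx).trans hX,
        (mulSpan_le.2 hXX).trans hY⟩, (mulSpan_le.2 hYX).trans hZ⟩,
      mulSpan_le_of_mul_eq_zero fun x hx y hy => P.db x (hZD hx) y (hXB hy)⟩,
    ⟨⟨mulSpan_le_of_mul_eq_zero fun x hx y hy => P.ac x (hM hx) y (hYC hy),
        (mulSpan_le.2 hXY).trans h1⟩, (mulSpan_le.2 hYY).trans hX⟩,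
      (mulSpan_le.2 hZY).trans hY⟩,
    ⟨⟨mulSpan_le_of_mul_eq_zero fun x hx y hy => P.ad x (hM hx) y (hZD hy),
        (mulSpan_le.2 hXZ).trans hX⟩,
        mulSpan_le_of_mul_eq_zero fun x hx y hy => P.cd x (hYC hx) y (hZD hy)⟩,
      (mulSpan_le.2 hZZ).trans hZ⟩

end Ideal

variable {A B C D : Submodule F U} (P : IsPeirce A B C D) (h : IsAlternativeRing U)
  (h2 : ∀ u : U, u + u = 0 → u = 0) [FiniteDimensional F U]
include P h h2

theorem peirceIdeal_nil {M : Submodule F U} (hM : M ≤ A)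
    (hI : ∀ x ∈ M, ∀ y ∈ A, y * x ∈ M ∧ x * y ∈ M) (hnil : ∀ x ∈ M, IsNilElem x) :
    ∀ x ∈ peirceIdeal B C M, IsNilElem x := by
  induction M using WellFoundedLT.induction with
  | _ M ih =>
  have hMM : mulSpan M M ≤ M := mulSpan_le.2 fun x hx y hy => (hI y hy x (hM hx)).1
  intro x hx
  rcases hMM.eq_or_lt with heq | hlt
  · have hbot := eq_bot_of_le_mulSpan_self h h2 hMM hnil heq.ge
    have : peirceIdeal B C M = ⊥ := by simp [peirceIdeal, mulSpan, hbot]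
    rw [this, Submodule.mem_bot] at hx
    exact ⟨0, hx⟩
  · exact h.isNilElem_of_mul_self h2 (ih _ hlt (hMM.trans hM) (mulSpan_self_ideal h hI)
      (fun y hy => hnil y (hMM hy)) _
      (mulSpan_le.1 (P.mulSpan_peirceIdeal_le h hM hI) x hx x hx))

/-- The nilradical of the Peirce component `A` is the intersection of the nilradical of `U`
with `A`. -/
theorem nilradical_eq {N N' : Submodule F U}
    (hNideal : ∀ x ∈ N, ∀ y : U, y * x ∈ N ∧ x * y ∈ N)
    (hNnil : ∀ x ∈ N, IsNilElem x)
    (hNmax : ∀ K : Submodule F U, (∀ x ∈ K, ∀ y : U, y * x ∈ K ∧ x * y ∈ K) →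
      (∀ x ∈ K, IsNilElem x) → K ≤ N)
    (hle : N' ≤ A)
    (hideal : ∀ x ∈ N', ∀ y ∈ A, y * x ∈ N' ∧ x * y ∈ N')
    (hnil : ∀ x ∈ N', IsNilElem x)
    (hmax : ∀ K : Submodule F U, K ≤ A → (∀ x ∈ K, ∀ y ∈ A, y * x ∈ K ∧ x * y ∈ K) →
      (∀ x ∈ K, IsNilElem x) → K ≤ N') :
    N' = N ⊓ A := by
  refine le_antisymm (le_inf ?_ hle) (hmax _ inf_le_right ?_ fun x hx => hNnil x hx.1)
  · exact (le_sup_left.trans (le_sup_left.trans le_sup_left)).trans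
      (hNmax (peirceIdeal B C N') (P.peirceIdeal_ideal h hle hideal)
        (P.peirceIdeal_nil h h2 hle hideal hnil))
  · exact fun x hx y hy => ⟨⟨(hNideal x hx.1 y).1, P.aa y hy x hx.2⟩,
      ⟨(hNideal x hx.1 y).2, P.aa x hx.2 y hy⟩⟩

end IsPeirce

/-- The simultaneous eigenspace of left and right multiplication by `e` with eigenvalues
`i` and `j`. -/
def peirceSpace (e : U) (i j : F) : Submodule F U where
  carrier := {x | e * x = i • x ∧ x * e = j • x}
  add_mem' := by
    rintro a b ⟨ha1, ha2⟩ ⟨hb1, hb2⟩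
    exact ⟨by rw [mul_add, ha1, hb1, smul_add], by rw [add_mul, ha2, hb2, smul_add]⟩
  zero_mem' := by simp
  smul_mem' := by
    rintro c a ⟨ha1, ha2⟩
    exact ⟨by rw [mul_smul_comm, ha1, smul_comm], by rw [smul_mul_assoc, ha2, smul_comm]⟩

lemma peirceSpace_one_one (e : U) : peirceSpace e (1 : F) 1 = peirceOneOne F U e := by
  ext x
  simp [peirceSpace, peirceOneOne]

lemma peirceSpace_zero_zero (e : U) : peirceSpace e (0 : F) 0 = peirceZeroZero F U e := by
  ext x
  simp [peirceSpace, peirceZeroZero]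

lemma mul_mem_peirceSpace (h : IsAlternativeRing U) {e x y : U} {i j k l : F}
    (hx : x ∈ peirceSpace e i j) (hy : y ∈ peirceSpace e k l) :
    x * y ∈ peirceSpace e (i + j - k) (l + k - j) := by
  have h1 := h.mul_mul_add_left_swap e x y
  have h3 := h.mul_mul_add_right_swap x y e
  rw [hx.1, hx.2, hy.1] at h1
  rw [hx.2, hy.1, hy.2] at h3
  simp only [smul_mul_assoc, mul_smul_comm] at h1 h3
  exact ⟨by rw [sub_smul, add_smul, h1, add_sub_cancel_right],
    by rw [sub_smul, add_smul, ← h3, add_sub_cancel_right]⟩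

lemma eq_zero_of_mem_peirceSpace (h : IsAlternativeRing U) {e p : U} (he : e * e = e) {i j : F}
    (hp : p ∈ peirceSpace e i j) (hij : i * i - i ≠ 0 ∨ j * j - j ≠ 0) : p = 0 := by
  have h1 := (h e p).1
  have h3 := (h e p).2
  rw [he, hp.1, mul_smul_comm, hp.1, smul_smul, eq_comm, ← sub_eq_zero, ← sub_smul] at h1
  rw [he, hp.2, smul_mul_assoc, hp.2, smul_smul, ← sub_eq_zero, ← sub_smul] at h3
  rcases hij with hi | hj
  · exact (smul_eq_zero.1 h1).resolve_left hi
  · exact (smul_eq_zero.1 h3).resolve_left hj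

/-- The Peirce decomposition relative to an idempotent. -/
theorem IsPeirce.of_isIdempotent (h : IsAlternativeRing U) (h2 : (2 : F) ≠ 0) {e : U}
    (he : e * e = e) :
    IsPeirce (peirceSpace e (1 : F) 1) (peirceSpace e 1 0) (peirceSpace e 0 1)
      (peirceSpace e 0 0) := by
  have mem : ∀ {i j k l : F} (s t : F), s = i + j - k → t = l + k - j →
      ∀ x ∈ peirceSpace e i j, ∀ y ∈ peirceSpace e k l, x * y ∈ peirceSpace e s t := by
    rintro i j k l _ _ rfl rfl x hx y hy
    exact mul_mem_peirceSpace h hx hy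
  have zero : ∀ {i j k l : F} (s t : F), s = i + j - k → t = l + k - j →
      s * s - s = 2 ∨ t * t - t = 2 →
      ∀ x ∈ peirceSpace e i j, ∀ y ∈ peirceSpace e k l, x * y = 0 := by
    intro i j k l s t hs ht hst x hx y hy
    exact eq_zero_of_mem_peirceSpace h he (mem s t hs ht x hx y hy)
      (hst.imp (fun h' => h'.trans_ne h2) (fun h' => h'.trans_ne h2))
  refine ⟨mem _ _ ?_ ?_, mem _ _ ?_ ?_, zero 2 0 ?_ ?_ ?_, zero 2 (-1) ?_ ?_ ?_,
    zero 0 2 ?_ ?_ ?_, mem _ _ ?_ ?_, mem _ _ ?_ ?_, mem _ _ ?_ ?_,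
    mem _ _ ?_ ?_, mem _ _ ?_ ?_, mem _ _ ?_ ?_, zero 1 (-1) ?_ ?_ ?_,
    zero (-1) 2 ?_ ?_ ?_, zero (-1) 1 ?_ ?_ ?_, mem _ _ ?_ ?_, mem _ _ ?_ ?_, ?_⟩
  on_goal 39 =>
    refine eq_top_iff.2 fun x _ => ?_
    have hl : ∀ z, e * (e * z) = e * z := fun z => by rw [← (h e z).1, he]
    have hr : ∀ z, z * e * e = z * e := fun z => by rw [(h e z).2, he]
    have hf : ∀ z, e * z * e = e * (z * e) := h.flexible e
    have hx : x = e * (x * e) + (e * x - e * (x * e)) + (x * e - e * (x * e)) +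
        (x - e * x - x * e + e * (x * e)) := by abel
    rw [hx]
    refine Submodule.add_mem_sup (Submodule.add_mem_sup (Submodule.add_mem_sup ?_ ?_) ?_) ?_ <;>
    constructor <;>
    simp [mul_sub, sub_mul, mul_add, add_mul, hl, ← hf, hr]
  all_goals norm_num

end Alternative

/-- Let `U` be a finite-dimensional alternative algebra over `F` with a
nontrivial idempotent `e` and Peirce decomposition
`U = U_{11} ⊕ U_{10} ⊕ U_{01} ⊕ U_{00}`.  If `N` is the nilradical of `U` and
`N_i` is the nilradical of the subalgebra `U_{ii}` `(i = 0, 1)`, then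
`N_i = N ∩ U_{ii}`. -/
theorem nilradical_peirce_diagonal
    (F : Type*) [Field F]
    (hchar : ringChar F ≠ 2 ∧ ringChar F ≠ 3 ∧ ringChar F ≠ 5)
    (U : Type*) [NonUnitalNonAssocRing U] [Module F U]
    [SMulCommClass F U U] [IsScalarTower F U U] [FiniteDimensional F U]
    (halt : ∀ x y : U, (x * x) * y = x * (x * y) ∧ (y * x) * x = y * (x * x))
    (e : U) (he : e * e = e) (he0 : e ≠ 0)
    (hent : ¬ ∀ x : U, e * x = x ∧ x * e = x)
    -- N is the nilradical of U: a nil two-sided ideal containing every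
    -- nil two-sided ideal of U
    (N : Submodule F U)
    (hNideal : ∀ x ∈ N, ∀ y : U, y * x ∈ N ∧ x * y ∈ N)
    (hNnil : ∀ x ∈ N, IsNilElem x)
    (hNmax : ∀ K : Submodule F U, (∀ x ∈ K, ∀ y : U, y * x ∈ K ∧ x * y ∈ K) →
      (∀ x ∈ K, IsNilElem x) → K ≤ N)
    -- N₁ is the nilradical of the subalgebra U₁₁
    (N1 : Submodule F U) (hN1le : N1 ≤ peirceOneOne F U e)
    (hN1ideal : ∀ x ∈ N1, ∀ y ∈ peirceOneOne F U e, y * x ∈ N1 ∧ x * y ∈ N1)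
    (hN1nil : ∀ x ∈ N1, IsNilElem x)
    (hN1max : ∀ K : Submodule F U, K ≤ peirceOneOne F U e →
      (∀ x ∈ K, ∀ y ∈ peirceOneOne F U e, y * x ∈ K ∧ x * y ∈ K) →
      (∀ x ∈ K, IsNilElem x) → K ≤ N1)
    -- N₀ is the nilradical of the subalgebra U₀₀
    (N0 : Submodule F U) (hN0le : N0 ≤ peirceZeroZero F U e)
    (hN0ideal : ∀ x ∈ N0, ∀ y ∈ peirceZeroZero F U e, y * x ∈ N0 ∧ x * y ∈ N0)
    (hN0nil : ∀ x ∈ N0, IsNilElem x)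
    (hN0max : ∀ K : Submodule F U, K ≤ peirceZeroZero F U e →
      (∀ x ∈ K, ∀ y ∈ peirceZeroZero F U e, y * x ∈ K ∧ x * y ∈ K) →
      (∀ x ∈ K, IsNilElem x) → K ≤ N0) :
    N1 = N ⊓ peirceOneOne F U e ∧ N0 = N ⊓ peirceZeroZero F U e := by
  have hF2 : (2 : F) ≠ 0 := Ring.two_ne_zero hchar.1
  have h2 : ∀ u : U, u + u = 0 → u = 0 := fun u hu => by
    rw [← two_smul F] at hu
    exact (smul_eq_zero.1 hu).resolve_left hF2
  have P := IsPeirce.of_isIdempotent (F := F) halt hF2 he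
  rw [← peirceSpace_one_one] at *
  rw [← peirceSpace_zero_zero] at *
  exact ⟨P.nilradical_eq halt h2 hNideal hNnil hNmax hN1le hN1ideal hN1nil hN1max,
    P.swap.nilradical_eq halt h2 hNideal hNnil hNmax hN0le hN0ideal hN0nil hN0max⟩
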